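/- Let σ² > 0, b_S > 0 and b_T > 0. Then the modified Gneiting model ψ(d,u) = σ²·(1 + |u|/b_T)^{−3}·exp(−d·(1 + |u|/b_T)/b_S), for (d,u) ∈ [0,π] × ℝ, is a geodesically isotropic, temporally symmetric covariance function on 𝕊² × ℝ; that is, the kernel ((s₁,t₁),(s₂,t₂)) ↦ ψ(d_GC(s₁,s₂), t₁ − t₂) is positive definite on 𝕊² × ℝ. -/

import Mathlib

open scoped RealInnerProductSpace

noncomputable def gcDist {n : ℕ} (x y : EuclideanSpace ℝ (Fin n)) : ℝ :=
  Real.arccos ⟪x, y⟫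

def IsPosDefKernel {X : Type*} (K : X → X → ℝ) : Prop :=
  ∀ (N : ℕ) (x : Fin N → X) (c : Fin N → ℝ),
    0 ≤ ∑ i : Fin N, ∑ j : Fin N, c i * c j * K (x i) (x j)

open Polynomial in
noncomputable def symPoly (n : ℕ) (A : Matrix (Fin 2) (Fin 2) ℂ) (k : ℕ) : ℂ[X] :=
  (C (A 0 0) * X + C (A 0 1)) ^ k * (C (A 1 0) * X + C (A 1 1)) ^ (n - k)

noncomputable def symM (n : ℕ) (A : Matrix (Fin 2) (Fin 2) ℂ) :
    Matrix (Fin (n + 1)) (Fin (n + 1)) ℂ :=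
  Matrix.of fun k l => (symPoly n A k).coeff l

lemma symM_expand_one (n : ℕ) (A : Matrix (Fin 2) (Fin 2) ℂ) (k : Fin (n + 1)) (T : ℂ) :
    ∑ l : Fin (n + 1), symM n A k l * T ^ (l : ℕ) =
      (A 0 0 * T + A 0 1) ^ (k : ℕ) * (A 1 0 * T + A 1 1) ^ (n - (k : ℕ)) := by
  have hdeg : (symPoly n A k).natDegree < n + 1 := by
    have h1 : (symPoly n A k).natDegree ≤ (k : ℕ) * 1 + (n - (k : ℕ)) * 1 := by
      unfold symPoly
      refine Polynomial.natDegree_mul_le_of_le ?_ ?_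
      · exact Polynomial.natDegree_pow_le_of_le _ Polynomial.natDegree_linear_le
      · exact Polynomial.natDegree_pow_le_of_le _ Polynomial.natDegree_linear_le
    have := k.2
    omega
  have h := Polynomial.eval_eq_sum_range' hdeg T
  rw [Finset.sum_range] at h
  simp only [symM, Matrix.of_apply]
  rw [← h]
  simp [symPoly]

lemma coeff_unique (n : ℕ) (u v : Fin (n + 1) → ℂ)
    (h : ∀ T : ℂ, ∑ l : Fin (n + 1), u l * T ^ (l : ℕ) = ∑ l : Fin (n + 1), v l * T ^ (l : ℕ)) :
    u = v := by
  have key : (∑ l : Fin (n + 1), Polynomial.C (u l) * Polynomial.X ^ (l : ℕ)) =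
      ∑ l : Fin (n + 1), Polynomial.C (v l) * Polynomial.X ^ (l : ℕ) := by
    apply Polynomial.funext
    intro T
    simpa [Polynomial.eval_finsetSum] using h T
  have hc : ∀ w : Fin (n + 1) → ℂ, ∀ m : Fin (n + 1),
      (∑ l : Fin (n + 1), Polynomial.C (w l) * Polynomial.X ^ (l : ℕ)).coeff (m : ℕ) = w m := by
    intro w m
    rw [Polynomial.finsetSum_coeff]
    simp only [Polynomial.coeff_C_mul_X_pow]
    rw [Finset.sum_eq_single m]
    · simp
    · intro b _ hb
      rw [if_neg]
      intro h
      exact hb (Fin.ext h.symm)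
    · simp
  funext m
  rw [← hc u m, key, hc]

lemma symM_expand (n : ℕ) (A : Matrix (Fin 2) (Fin 2) ℂ) (k : Fin (n + 1)) (x y : ℂ) :
    ∑ l : Fin (n + 1), symM n A k l * (x ^ (l : ℕ) * y ^ (n - (l : ℕ))) =
      (A 0 0 * x + A 0 1 * y) ^ (k : ℕ) * (A 1 0 * x + A 1 1 * y) ^ (n - (k : ℕ)) := by
  have hd : Dense ({0}ᶜ : Set ℂ) := dense_compl_singleton 0
  have := Continuous.ext_on (f := fun y : ℂ => ∑ l : Fin (n + 1), symM n A k l * (x ^ (l : ℕ) * y ^ (n - (l : ℕ))))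
    (g := fun y : ℂ => (A 0 0 * x + A 0 1 * y) ^ (k : ℕ) * (A 1 0 * x + A 1 1 * y) ^ (n - (k : ℕ)))
    hd (by fun_prop) (by fun_prop) ?_
  · exact congrFun this y
  · intro y hy
    have hy : y ≠ 0 := hy
    have h := symM_expand_one n A k (x / y)
    have hk : (k : ℕ) + (n - (k : ℕ)) = n := by have := k.2; omega
    have e1 : A 0 0 * x + A 0 1 * y = y * (A 0 0 * (x / y) + A 0 1) := by field_simp
    have e2 : A 1 0 * x + A 1 1 * y = y * (A 1 0 * (x / y) + A 1 1) := by field_simp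
    simp only
    rw [e1, e2, mul_pow, mul_pow, mul_mul_mul_comm, ← pow_add, hk, ← h, Finset.mul_sum]
    refine Finset.sum_congr rfl fun l _ => ?_
    have hl : n = (l : ℕ) + (n - (l : ℕ)) := by have := l.2; omega
    have : y ^ n = y ^ (l : ℕ) * y ^ (n - (l : ℕ)) := by rw [← pow_add, ← hl]
    rw [this, div_pow]
    field_simp

lemma symM_mul (n : ℕ) (A B : Matrix (Fin 2) (Fin 2) ℂ) :
    symM n (A * B) = symM n A * symM n B := by
  ext k m
  refine congrFun (coeff_unique n (fun m => symM n (A * B) k m)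
    (fun m => (symM n A * symM n B) k m) ?_) m
  intro T
  rw [symM_expand_one]
  simp only [Matrix.mul_apply, Finset.sum_mul]
  rw [Finset.sum_comm]
  simp only [mul_assoc, ← Finset.mul_sum]
  simp only [symM_expand_one]
  rw [symM_expand]
  simp only [Fin.sum_univ_two]
  congr 2 <;> ring

lemma symM_diag (n : ℕ) (a d : ℂ) :
    symM n !![a, 0; 0, d] = Matrix.diagonal fun k : Fin (n + 1) => a ^ (k : ℕ) * d ^ (n - (k : ℕ)) := by
  ext k m
  refine congrFun (coeff_unique n (fun m => symM n !![a, 0; 0, d] k m)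
    (fun m => Matrix.diagonal (fun k : Fin (n + 1) => a ^ (k : ℕ) * d ^ (n - (k : ℕ))) k m) ?_) m
  intro T
  rw [symM_expand_one]
  simp [Matrix.diagonal_apply, mul_pow]
  ring

lemma symM_one (n : ℕ) : symM n 1 = 1 := by
  rw [Matrix.one_fin_two, symM_diag]
  simp

lemma sum_choose (n : ℕ) (p q : ℂ) :
    ∑ k : Fin (n + 1), (n.choose k : ℂ) * (p ^ (k : ℕ) * q ^ (n - (k : ℕ))) = (p + q) ^ n := by
  rw [add_pow, Finset.sum_range]
  refine Finset.sum_congr rfl fun l _ => ?_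
  ring

lemma symM_herm (n : ℕ) (A : Matrix (Fin 2) (Fin 2) ℂ) (hA : A.IsHermitian) (k j : Fin (n + 1)) :
    (n.choose k : ℂ) * symM n A k j = (n.choose j : ℂ) * star (symM n A j k) := by
  have h00 : star (A 0 0) = A 0 0 := hA.apply 0 0
  have h11 : star (A 1 1) = A 1 1 := hA.apply 1 1
  have h01 : star (A 0 1) = A 1 0 := hA.apply 1 0
  have h10 : star (A 1 0) = A 0 1 := hA.apply 0 1
  have step : ∀ T : ℂ, (fun k : Fin (n + 1) => ∑ j : Fin (n + 1), (n.choose k : ℂ) * symM n A k j * T ^ (j : ℕ)) =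
      fun k => ∑ j : Fin (n + 1), (n.choose j : ℂ) * star (symM n A j k) * T ^ (j : ℕ) := by
    intro T
    refine coeff_unique n _ _ ?_
    intro s
    have e1 : ∑ k : Fin (n + 1), (∑ j : Fin (n + 1), (n.choose k : ℂ) * symM n A k j * T ^ (j : ℕ)) * s ^ (k : ℕ)
        = (s * (A 0 0 * T + A 0 1) + (A 1 0 * T + A 1 1)) ^ n := by
      rw [← sum_choose]
      refine Finset.sum_congr rfl fun k _ => ?_
      rw [mul_pow, mul_assoc, ← symM_expand_one, Finset.sum_mul, Finset.mul_sum, Finset.mul_sum]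
      refine Finset.sum_congr rfl fun l _ => ?_
      ring
    have e2 : ∑ k : Fin (n + 1), (∑ j : Fin (n + 1), (n.choose j : ℂ) * star (symM n A j k) * T ^ (j : ℕ)) * s ^ (k : ℕ)
        = (T * (A 0 0 * s + A 1 0) + (A 0 1 * s + A 1 1)) ^ n := by
      rw [← sum_choose]
      simp only [Finset.sum_mul]
      rw [Finset.sum_comm]
      refine Finset.sum_congr rfl fun j _ => ?_
      have h := congrArg star (symM_expand_one n A j (star s))
      simp only [star_sum, star_mul', star_pow, star_star, star_add, h00, h11, h01, h10] at h
      rw [mul_pow, mul_assoc, ← h, Finset.mul_sum, Finset.mul_sum]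
      refine Finset.sum_congr rfl fun l _ => ?_
      ring
    rw [e1, e2]
    congr 1
    ring
  have := coeff_unique n (fun j => (n.choose k : ℂ) * symM n A k j)
    (fun j => (n.choose j : ℂ) * star (symM n A j k)) (fun T => congrFun (step T) k)
  exact congrFun this j

/-- trace of the symmetric power. -/
lemma symM_trace (n : ℕ) (M : Matrix (Fin 2) (Fin 2) ℂ) (α β : ℂ)
    (htr : M 0 0 + M 1 1 = α + β) (hdet : M 0 0 * M 1 1 - M 0 1 * M 1 0 = α * β)
    (hb : M 0 1 = 0 → M 1 0 = 0) (hne : M 0 1 ≠ 0 → α ≠ β) :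
    (symM n M).trace = ∑ k : Fin (n + 1), α ^ (k : ℕ) * β ^ (n - (k : ℕ)) := by
  by_cases h : M 0 1 = 0
  · have hc := hb h
    have hM : M = !![M 0 0, 0; 0, M 1 1] := by
      ext i j; fin_cases i <;> fin_cases j <;> simp [h, hc]
    rw [h, zero_mul, sub_zero] at hdet
    have hz : (M 0 0 - α) * (M 0 0 - β) = 0 := by
      linear_combination M 0 0 * htr - hdet
    rw [hM, symM_diag, Matrix.trace_diagonal]
    rcases mul_eq_zero.mp hz with h1 | h1
    · have h0 : M 0 0 = α := by linear_combination h1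
      have h2 : M 1 1 = β := by linear_combination htr - h1
      rw [h0, h2]
    · have h0 : M 0 0 = β := by linear_combination h1
      have h2 : M 1 1 = α := by linear_combination htr - h1
      rw [h0, h2]
      rw [← Equiv.sum_comp Fin.revPerm]
      refine Finset.sum_congr rfl fun k _ => ?_
      have hk := k.2
      simp only [Fin.revPerm_apply, Fin.val_rev]
      rw [show n + 1 - ((k : ℕ) + 1) = n - k by omega, show n - (n - (k : ℕ)) = k by omega]
      ring
  · have hαβ := hne h
    set b := M 0 1 with hbdef
    set S : Matrix (Fin 2) (Fin 2) ℂ := !![b, b; α - M 0 0, β - M 0 0] with hS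
    have hSdet : IsUnit S.det := by
      rw [isUnit_iff_ne_zero, hS, Matrix.det_fin_two_of]
      have : b * (β - M 0 0) - b * (α - M 0 0) = b * (β - α) := by ring
      rw [this]
      exact mul_ne_zero h (sub_ne_zero.mpr hαβ.symm)
    have hMS : M * S = S * !![α, 0; 0, β] := by
      ext i j
      fin_cases i <;> fin_cases j <;> simp [Matrix.mul_apply, Fin.sum_univ_two, hS]
      · rw [← hbdef]; ring
      · rw [← hbdef]; ring
      · linear_combination (-1 : ℂ) * hdet + α * htr
      · linear_combination (-1 : ℂ) * hdet + β * htr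
    have hM : M = S * !![α, 0; 0, β] * S⁻¹ := by
      rw [← hMS, Matrix.mul_assoc, Matrix.mul_nonsing_inv _ hSdet, Matrix.mul_one]
    rw [hM, symM_mul, Matrix.trace_mul_comm, ← symM_mul, ← Matrix.mul_assoc,
      Matrix.nonsing_inv_mul _ hSdet, Matrix.one_mul, symM_diag, Matrix.trace_diagonal]

noncomputable def pauli (x : EuclideanSpace ℝ (Fin 3)) : Matrix (Fin 2) (Fin 2) ℂ :=
  !![(x 2 : ℂ), (x 0 : ℂ) - Complex.I * (x 1 : ℂ); (x 0 : ℂ) + Complex.I * (x 1 : ℂ), -(x 2 : ℂ)]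

lemma pauli_herm (x : EuclideanSpace ℝ (Fin 3)) : (pauli x).IsHermitian := by
  ext i j
  fin_cases i <;> fin_cases j <;> simp [pauli] <;> ring

noncomputable def Dn (n : ℕ) (θ : ℝ) : ℝ := ∑ k ∈ Finset.range (n + 1), Real.cos ((2 * k - n) * θ)

lemma sq_sum_sphere (x : EuclideanSpace ℝ (Fin 3)) (hx : ‖x‖ = 1) : x 0 ^ 2 + x 1 ^ 2 + x 2 ^ 2 = 1 := by
  have := EuclideanSpace.norm_sq_eq x
  rw [hx, Fin.sum_univ_three] at this
  simp only [Real.norm_eq_abs, sq_abs] at this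
  linarith

lemma inner3 (x y : EuclideanSpace ℝ (Fin 3)) : ⟪x, y⟫ = x 0 * y 0 + x 1 * y 1 + x 2 * y 2 := by
  rw [PiLp.inner_apply, Fin.sum_univ_three]
  simp
  ring

lemma trace_pauli (n : ℕ) (x y : EuclideanSpace ℝ (Fin 3)) (hx : ‖x‖ = 1) (hy : ‖y‖ = 1) :
    ((symM n (pauli x * pauli y)).trace).re = Dn n (gcDist x y) := by
  set θ := gcDist x y with hθ
  have hcos : Real.cos θ = x 0 * y 0 + x 1 * y 1 + x 2 * y 2 := by
    rw [← inner3, hθ, gcDist, Real.cos_arccos]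
    · have := abs_le.mp (abs_real_inner_le_norm x y); rw [hx, hy] at this; linarith [this.1]
    · have := abs_le.mp (abs_real_inner_le_norm x y); rw [hx, hy] at this; linarith [this.2]
  have sx := sq_sum_sphere x hx
  have sy := sq_sum_sphere y hy
  have sxc : (x 0 : ℂ) ^ 2 + (x 1 : ℂ) ^ 2 + (x 2 : ℂ) ^ 2 = 1 := by
    have := congrArg Complex.ofReal sx; push_cast at this; exact this
  have syc : (y 0 : ℂ) ^ 2 + (y 1 : ℂ) ^ 2 + (y 2 : ℂ) ^ 2 = 1 := by
    have := congrArg Complex.ofReal sy; push_cast at this; exact this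
  have hcosc : Complex.cos θ = (x 0 : ℂ) * y 0 + x 1 * y 1 + x 2 * y 2 := by exact_mod_cast congrArg Complex.ofReal hcos
  have hI := Complex.I_sq
  have e00 : (pauli x * pauli y) 0 0 = x 2 * y 2 + ((x 0 : ℂ) - Complex.I * x 1) * (y 0 + Complex.I * y 1) := by
    simp [pauli, Matrix.mul_apply, Fin.sum_univ_two]
  have e11 : (pauli x * pauli y) 1 1 = ((x 0 : ℂ) + Complex.I * x 1) * (y 0 - Complex.I * y 1) + x 2 * y 2 := by
    simp [pauli, Matrix.mul_apply, Fin.sum_univ_two]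
  have e01 : (pauli x * pauli y) 0 1 = ((x 2 * y 0 - x 0 * y 2 : ℝ) : ℂ) + ((x 1 * y 2 - x 2 * y 1 : ℝ) : ℂ) * Complex.I := by
    simp [pauli, Matrix.mul_apply, Fin.sum_univ_two]; ring
  have e10 : (pauli x * pauli y) 1 0 = -((x 2 * y 0 - x 0 * y 2 : ℝ) : ℂ) + ((x 1 * y 2 - x 2 * y 1 : ℝ) : ℂ) * Complex.I := by
    simp [pauli, Matrix.mul_apply, Fin.sum_univ_two]; ring
  have hz : (pauli x * pauli y) 0 1 = 0 → (x 2 * y 0 - x 0 * y 2 = 0 ∧ x 1 * y 2 - x 2 * y 1 = 0) := by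
    intro h
    rw [e01] at h
    have h1 := congrArg Complex.re h
    have h2 := congrArg Complex.im h
    rw [← Complex.mk_eq_add_mul_I] at h1 h2
    exact ⟨h1, h2⟩
  rw [symM_trace n _ (Complex.exp (θ * Complex.I)) (Complex.exp (-(θ * Complex.I)))]
  · rw [Dn, Finset.sum_range, Complex.re_sum]
    refine Finset.sum_congr rfl fun k _ => ?_
    rw [← Complex.exp_nat_mul, ← Complex.exp_nat_mul, ← Complex.exp_add]
    have hk : (k : ℕ) ≤ n := by have := k.2; omega
    rw [Nat.cast_sub hk]
    have : (k : ℂ) * (θ * Complex.I) + ((n : ℂ) - (k : ℕ)) * -(θ * Complex.I) = (((2 * (k : ℕ) - n) * θ : ℝ) : ℂ) * Complex.I := by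
      push_cast; ring
    rw [this, Complex.exp_ofReal_mul_I_re]
  · rw [e00, e11, ← neg_mul, ← Complex.two_cos, hcosc]
    linear_combination (-2 * (x 1 : ℂ) * y 1) * hI
  · rw [← Complex.exp_add, add_neg_cancel, Complex.exp_zero]
    have : (pauli x * pauli y) 0 0 * (pauli x * pauli y) 1 1 - (pauli x * pauli y) 0 1 * (pauli x * pauli y) 1 0 = (pauli x).det * (pauli y).det := by
      rw [← Matrix.det_mul, Matrix.det_fin_two (pauli x * pauli y)]
    rw [this, pauli, pauli, Matrix.det_fin_two_of, Matrix.det_fin_two_of]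
    have d : ∀ a b c : ℂ, a ^ 2 + b ^ 2 + c ^ 2 = 1 → c * -c - (a - Complex.I * b) * (a + Complex.I * b) = -1 := by
      intro a b c h
      linear_combination -h + b ^ 2 * hI
    rw [d _ _ _ sxc, d _ _ _ syc]; norm_num
  · intro h
    obtain ⟨h1, h2⟩ := hz h
    rw [e10, h1, h2]; simp
  · intro h heq
    apply h
    -- sin θ = 0
    have hs : Real.sin θ = 0 := by
      have := congrArg Complex.im heq
      rw [← neg_mul, ← Complex.ofReal_neg, Complex.exp_ofReal_mul_I_im, Complex.exp_ofReal_mul_I_im, Real.sin_neg] at this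
      linarith
    have h1 := Real.sin_sq_add_cos_sq θ
    rw [hs, hcos] at h1
    have hL : (x 2 * y 0 - x 0 * y 2) ^ 2 + (x 1 * y 2 - x 2 * y 1) ^ 2 + (x 0 * y 1 - x 1 * y 0) ^ 2 = 0 := by
      linear_combination sx * (y 0 ^ 2 + y 1 ^ 2 + y 2 ^ 2) + sy - h1
    have z1 : x 2 * y 0 - x 0 * y 2 = 0 := by
      have : (x 2 * y 0 - x 0 * y 2) ^ 2 = 0 := by nlinarith [sq_nonneg (x 2 * y 0 - x 0 * y 2), sq_nonneg (x 1 * y 2 - x 2 * y 1), sq_nonneg (x 0 * y 1 - x 1 * y 0)]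
      exact pow_eq_zero_iff (two_ne_zero) |>.mp this
    have z2 : x 1 * y 2 - x 2 * y 1 = 0 := by
      have : (x 1 * y 2 - x 2 * y 1) ^ 2 = 0 := by nlinarith [sq_nonneg (x 2 * y 0 - x 0 * y 2), sq_nonneg (x 1 * y 2 - x 2 * y 1), sq_nonneg (x 0 * y 1 - x 1 * y 0)]
      exact pow_eq_zero_iff (two_ne_zero) |>.mp this
    rw [e01, z1, z2]; simp

abbrev S2 := Metric.sphere (0 : EuclideanSpace ℝ (Fin 3)) 1

lemma S2.norm_eq (x : S2) : ‖(x : EuclideanSpace ℝ (Fin 3))‖ = 1 := by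
  simp

lemma Dn_posdef (n : ℕ) : IsPosDefKernel (fun x y : S2 => Dn n (gcDist (x : EuclideanSpace ℝ (Fin 3)) y)) := by
  intro N x c
  have key : ∀ i j, Dn n (gcDist (x i : EuclideanSpace ℝ (Fin 3)) (x j)) =
      ∑ k : Fin (n + 1), ∑ l : Fin (n + 1), ((n.choose k : ℝ) / (n.choose l : ℝ)) *
        (symM n (pauli (x i)) k l * star (symM n (pauli (x j)) k l)).re := by
    intro i j
    rw [← trace_pauli n _ _ (S2.norm_eq _) (S2.norm_eq _), symM_mul, Matrix.trace]
    simp only [Matrix.diag_apply, Matrix.mul_apply, Complex.re_sum]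
    refine Finset.sum_congr rfl fun k _ => Finset.sum_congr rfl fun l _ => ?_
    have h := symM_herm n (pauli (x j)) (pauli_herm _) l k
    have hl : (n.choose l : ℂ) ≠ 0 := by
      exact_mod_cast (Nat.choose_pos (by have := l.2; omega)).ne'
    have : symM n (pauli (x j)) l k = (((n.choose k : ℝ) / (n.choose l : ℝ) : ℝ) : ℂ) * star (symM n (pauli (x j)) k l) := by
      push_cast
      field_simp
      linear_combination h
    rw [this, mul_left_comm, Complex.re_ofReal_mul]
  have : ∑ i, ∑ j, c i * c j * Dn n (gcDist (x i : EuclideanSpace ℝ (Fin 3)) (x j)) =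
      ∑ k : Fin (n + 1), ∑ l : Fin (n + 1), ((n.choose k : ℝ) / (n.choose l : ℝ)) *
        ((∑ i, c i * (symM n (pauli (x i)) k l).re) ^ 2 + (∑ i, c i * (symM n (pauli (x i)) k l).im) ^ 2) := by
    simp only [key, Finset.mul_sum]
    have : ∀ i : Fin N, ∑ j, ∑ k : Fin (n + 1), ∑ l : Fin (n + 1), c i * c j * (((n.choose k : ℝ) / (n.choose l : ℝ)) *
        (symM n (pauli (x i)) k l * star (symM n (pauli (x j)) k l)).re) = ∑ k : Fin (n + 1), ∑ l : Fin (n + 1), ∑ j, c i * c j * (((n.choose k : ℝ) / (n.choose l : ℝ)) *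
        (symM n (pauli (x i)) k l * star (symM n (pauli (x j)) k l)).re) := by
      intro i
      rw [Finset.sum_comm]
      refine Finset.sum_congr rfl fun k _ => ?_
      rw [Finset.sum_comm]
    simp only [this]
    rw [Finset.sum_comm]
    refine Finset.sum_congr rfl fun k _ => ?_
    rw [Finset.sum_comm]
    refine Finset.sum_congr rfl fun l _ => ?_
    rw [sq, sq, Finset.sum_mul_sum, Finset.sum_mul_sum, ← Finset.sum_add_distrib, Finset.mul_sum]
    refine Finset.sum_congr rfl fun i _ => ?_
    rw [← Finset.sum_add_distrib, Finset.mul_sum]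
    refine Finset.sum_congr rfl fun j _ => ?_
    simp [Complex.mul_re]
    ring
  show 0 ≤ ∑ i, ∑ j, c i * c j * Dn n (gcDist (x i : EuclideanSpace ℝ (Fin 3)) (x j))
  rw [this]
  positivity

open Finset in
lemma Dn_succ_succ (n : ℕ) (θ : ℝ) : Dn (n + 2) θ = Dn n θ + 2 * Real.cos ((n + 2 : ℕ) * θ) := by
  unfold Dn
  rw [Finset.sum_range_succ, Finset.sum_range_succ']
  have h1 : ∀ k ∈ Finset.range (n + 1), Real.cos ((2 * ((k + 1 : ℕ) : ℝ) - ((n + 2 : ℕ) : ℝ)) * θ) = Real.cos ((2 * k - n) * θ) := by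
    intro k _
    congr 1
    push_cast
    ring
  rw [Finset.sum_congr rfl h1]
  have h2 : Real.cos ((2 * ((0 : ℕ) : ℝ) - ((n + 2 : ℕ) : ℝ)) * θ) = Real.cos ((n + 2 : ℕ) * θ) := by
    rw [← Real.cos_neg]; congr 1; push_cast; ring
  have h3 : Real.cos ((2 * ((n + 2 : ℕ) : ℝ) - ((n + 2 : ℕ) : ℝ)) * θ) = Real.cos ((n + 2 : ℕ) * θ) := by
    congr 1; push_cast; ring
  rw [h2, h3]; ring

lemma Dn_zero (θ : ℝ) : Dn 0 θ = 1 := by simp [Dn]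

lemma Dn_one (θ : ℝ) : Dn 1 θ = 2 * Real.cos θ := by
  simp [Dn, Finset.sum_range_succ]
  rw [show (2 - 1 : ℝ) * θ = θ by ring]; ring

lemma abel_Dn (F : ℕ → ℝ) (θ : ℝ) (N : ℕ) :
    F 0 + ∑ m ∈ Finset.range (N + 1), 2 * F (m + 1) * Real.cos ((m + 1 : ℕ) * θ) =
      ∑ m ∈ Finset.range N, (F m - F (m + 2)) * Dn m θ + F N * Dn N θ + F (N + 1) * Dn (N + 1) θ := by
  induction N with
  | zero => simp [Dn_zero, Dn_one]; ring
  | succ N ih =>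
    rw [Finset.sum_range_succ, ← add_assoc, ih, Finset.sum_range_succ _ N, Dn_succ_succ]
    ring

lemma cos_series_posdef (F : ℕ → ℝ) (hF : ∀ m, 0 ≤ F m) (hm : ∀ m, F (m + 2) ≤ F m) (g : ℝ → ℝ)
    (hs : ∀ θ ∈ Set.Icc 0 Real.pi,
      HasSum (fun m : ℕ => 2 * F (m + 1) * Real.cos ((m + 1 : ℕ) * θ)) (g θ - F 0)) :
    IsPosDefKernel (fun x y : S2 => g (gcDist (x : EuclideanSpace ℝ (Fin 3)) y)) := by
  intro N x c
  have hlim : Filter.Tendsto (fun M : ℕ => ∑ i, ∑ j, c i * c j *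
      (F 0 + ∑ m ∈ Finset.range (M + 1), 2 * F (m + 1) * Real.cos ((m + 1 : ℕ) * gcDist (x i : EuclideanSpace ℝ (Fin 3)) (x j))))
      Filter.atTop (nhds (∑ i, ∑ j, c i * c j * g (gcDist (x i : EuclideanSpace ℝ (Fin 3)) (x j)))) := by
    refine tendsto_finsetSum _ fun i _ => tendsto_finsetSum _ fun j _ => ?_
    refine Filter.Tendsto.const_mul _ ?_
    have h := (hs (gcDist (x i : EuclideanSpace ℝ (Fin 3)) (x j)) ⟨Real.arccos_nonneg _, Real.arccos_le_pi _⟩).tendsto_sum_nat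
    have h2 := (h.comp (Filter.tendsto_add_atTop_nat 1)).const_add (F 0)
    simpa using h2
  refine ge_of_tendsto' hlim fun M => ?_
  simp only [abel_Dn]
  have : ∑ i, ∑ j, c i * c j * (∑ m ∈ Finset.range M, (F m - F (m + 2)) * Dn m (gcDist (x i : EuclideanSpace ℝ (Fin 3)) (x j)) + F M * Dn M (gcDist (x i : EuclideanSpace ℝ (Fin 3)) (x j)) + F (M + 1) * Dn (M + 1) (gcDist (x i : EuclideanSpace ℝ (Fin 3)) (x j)))
    = ∑ m ∈ Finset.range M, (F m - F (m + 2)) * ∑ i, ∑ j, c i * c j * Dn m (gcDist (x i : EuclideanSpace ℝ (Fin 3)) (x j))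
      + F M * ∑ i, ∑ j, c i * c j * Dn M (gcDist (x i : EuclideanSpace ℝ (Fin 3)) (x j))
      + F (M + 1) * ∑ i, ∑ j, c i * c j * Dn (M + 1) (gcDist (x i : EuclideanSpace ℝ (Fin 3)) (x j)) := by
    simp only [Finset.mul_sum, mul_add, Finset.sum_add_distrib]
    congr 1
    · congr 1
      · symm
        rw [Finset.sum_comm]
        refine Finset.sum_congr rfl fun i _ => ?_
        rw [Finset.sum_comm]
        refine Finset.sum_congr rfl fun j _ => Finset.sum_congr rfl fun m _ => ?_
        ring
      · refine Finset.sum_congr rfl fun i _ => Finset.sum_congr rfl fun j _ => ?_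
        ring
    · refine Finset.sum_congr rfl fun i _ => Finset.sum_congr rfl fun j _ => ?_
      ring
  rw [this]
  have hD : ∀ m, 0 ≤ ∑ i, ∑ j, c i * c j * Dn m (gcDist (x i : EuclideanSpace ℝ (Fin 3)) (x j)) :=
    fun m => Dn_posdef m N x c
  have h1 := mul_nonneg (hF M) (hD M)
  have h2 := mul_nonneg (hF (M + 1)) (hD (M + 1))
  have h3 : 0 ≤ ∑ m ∈ Finset.range M, (F m - F (m + 2)) * ∑ i, ∑ j, c i * c j * Dn m (gcDist (x i : EuclideanSpace ℝ (Fin 3)) (x j)) :=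
    Finset.sum_nonneg fun m _ => mul_nonneg (sub_nonneg.mpr (hm m)) (hD m)
  linarith

/-! Fourier sums -/

lemma bern2 : Polynomial.bernoulli 2 = Polynomial.X ^ 2 - Polynomial.X + Polynomial.C (6⁻¹ : ℚ) := by
  rw [Polynomial.bernoulli]
  simp only [Finset.sum_range_succ, bernoulli_one, bernoulli_two, bernoulli_zero, ← Polynomial.C_mul_X_pow_eq_monomial]
  norm_num [Nat.choose]
  ring

lemma hasSum_cong {f g : ℕ → ℝ} {a b : ℝ} (h : HasSum f a) (hf : g = f) (ha : b = a) : HasSum g b := by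
  subst hf; subst ha; exact h

lemma bern3 : Polynomial.bernoulli 3 = Polynomial.X ^ 3 - Polynomial.C (3/2 : ℚ) * Polynomial.X ^ 2 + Polynomial.C (1/2 : ℚ) * Polynomial.X := by
  have b3 : bernoulli 3 = 0 := by
    rw [bernoulli_eq_bernoulli'_of_ne_one (by decide), bernoulli'_three]
  rw [Polynomial.bernoulli]
  simp only [Finset.sum_range_succ, bernoulli_one, bernoulli_two, bernoulli_zero, b3, ← Polynomial.C_mul_X_pow_eq_monomial]
  norm_num [Nat.choose]
  ring

lemma C2_sum (x : ℝ) (hx : x ∈ Set.Icc 0 (2 * Real.pi)) :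
    HasSum (fun m : ℕ => 1 / ((m + 1 : ℕ) : ℝ) ^ 2 * Real.cos ((m + 1 : ℕ) * x))
      (Real.pi ^ 2 / 6 - Real.pi * x / 2 + x ^ 2 / 4) := by
  have hpi := Real.pi_pos
  have h := hasSum_one_div_nat_pow_mul_cos (k := 1) one_ne_zero (x := x / (2 * Real.pi))
    ⟨div_nonneg hx.1 (by positivity), (div_le_one (by positivity)).mpr hx.2⟩
  rw [show 2 * 1 = 2 from rfl, bern2] at h
  have h' := (hasSum_nat_add_iff' 1).mpr h
  refine hasSum_cong h' ?_ ?_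
  · funext m
    congr 2
    field_simp
  · simp [Nat.factorial]
    field_simp
    ring

lemma S3_sum (x : ℝ) (hx : x ∈ Set.Icc 0 (2 * Real.pi)) :
    HasSum (fun m : ℕ => 1 / ((m + 1 : ℕ) : ℝ) ^ 3 * Real.sin ((m + 1 : ℕ) * x))
      (Real.pi ^ 2 * x / 6 - Real.pi * x ^ 2 / 4 + x ^ 3 / 12) := by
  have hpi := Real.pi_pos
  have h := hasSum_one_div_nat_pow_mul_sin (k := 1) one_ne_zero (x := x / (2 * Real.pi))
    ⟨div_nonneg hx.1 (by positivity), (div_le_one (by positivity)).mpr hx.2⟩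
  rw [show 2 * 1 + 1 = 3 from rfl, bern3] at h
  have h' := (hasSum_nat_add_iff' 1).mpr h
  refine hasSum_cong h' ?_ ?_
  · funext m
    congr 2
    field_simp
  · simp [Nat.factorial]
    field_simp
    ring

lemma cusa (x : ℝ) (hx : 0 ≤ x) : 3 * Real.sin x ≤ 2 * x + x * Real.cos x := by
  have hpi := Real.pi_gt_three
  rcases le_or_gt x Real.pi with h | h
  · have m1 : MonotoneOn (fun x : ℝ => Real.sin x - x * Real.cos x) (Set.Icc 0 Real.pi) := by
      refine monotoneOn_of_deriv_nonneg (convex_Icc _ _) (by fun_prop) (by fun_prop) ?_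
      intro y hy
      rw [interior_Icc] at hy
      have : HasDerivAt (fun x : ℝ => Real.sin x - x * Real.cos x) (Real.cos y - (1 * Real.cos y + y * (-Real.sin y))) y :=
        (Real.hasDerivAt_sin y).sub ((hasDerivAt_id y).mul (Real.hasDerivAt_cos y))
      rw [this.deriv]
      have := mul_nonneg hy.1.le (Real.sin_nonneg_of_nonneg_of_le_pi hy.1.le hy.2.le)
      linarith
    have m2 : MonotoneOn (fun x : ℝ => 2 * x - 2 * Real.sin x - (Real.sin x - x * Real.cos x)) (Set.Icc 0 Real.pi) := by
      have m3 : MonotoneOn (fun x : ℝ => 2 - 2 * Real.cos x - x * Real.sin x) (Set.Icc 0 Real.pi) := by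
        refine monotoneOn_of_deriv_nonneg (convex_Icc _ _) (by fun_prop) (by fun_prop) ?_
        intro y hy
        rw [interior_Icc] at hy
        have : HasDerivAt (fun x : ℝ => 2 - 2 * Real.cos x - x * Real.sin x) (0 - 2 * (-Real.sin y) - (1 * Real.sin y + y * (Real.cos y))) y :=
          ((hasDerivAt_const y (2:ℝ)).sub ((Real.hasDerivAt_cos y).const_mul 2)).sub ((hasDerivAt_id y).mul (Real.hasDerivAt_sin y))
        rw [this.deriv]
        have := m1 ⟨le_rfl, by linarith⟩ ⟨hy.1.le, hy.2.le⟩ hy.1.le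
        simp at this
        linarith
      refine monotoneOn_of_deriv_nonneg (convex_Icc _ _) (by fun_prop) (by fun_prop) ?_
      intro y hy
      rw [interior_Icc] at hy
      have : HasDerivAt (fun x : ℝ => 2 * x - 2 * Real.sin x - (Real.sin x - x * Real.cos x)) (2 * 1 - 2 * Real.cos y - (Real.cos y - (1 * Real.cos y + y * (-Real.sin y)))) y :=
        (((hasDerivAt_id y).const_mul 2).sub ((Real.hasDerivAt_sin y).const_mul 2)).sub ((Real.hasDerivAt_sin y).sub ((hasDerivAt_id y).mul (Real.hasDerivAt_cos y)))
      rw [this.deriv]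
      have := m3 ⟨le_rfl, by linarith⟩ ⟨hy.1.le, hy.2.le⟩ hy.1.le
      simp at this
      linarith
    have := m2 ⟨le_rfl, by linarith⟩ ⟨hx, h⟩ hx
    simp at this
    linarith
  · have h1 := Real.sin_le_one x
    have h2 := Real.neg_one_le_cos x
    nlinarith

lemma sub_sin_le (x : ℝ) (hx : 0 ≤ x) : x - Real.sin x ≤ x ^ 3 / 6 := by
  have m : MonotoneOn (fun x : ℝ => x ^ 3 / 6 - x + Real.sin x) (Set.Ici 0) := by
    refine monotoneOn_of_deriv_nonneg (convex_Ici _) (by fun_prop) (by fun_prop) ?_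
    intro y hy
    have : HasDerivAt (fun x : ℝ => x ^ 3 / 6 - x + Real.sin x) ((3 : ℕ) * y ^ (3 - 1) / 6 - 1 + Real.cos y) y :=
      (((hasDerivAt_pow 3 y).div_const 6).sub (hasDerivAt_id y)).add (Real.hasDerivAt_sin y)
    rw [this.deriv]
    have := Real.one_sub_sq_div_two_le_cos (x := y)
    norm_num
    linarith
  have := m (Set.mem_Ici.mpr le_rfl) (Set.mem_Ici.mpr hx) hx
  simp at this
  linarith

lemma phi_anti : AntitoneOn (fun x : ℝ => (x - Real.sin x) / x ^ 3) (Set.Ioi 0) := by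
  have hd : ∀ y : ℝ, 0 < y → HasDerivAt (fun x : ℝ => (x - Real.sin x) / x ^ 3)
      (((1 - Real.cos y) * y ^ 3 - (y - Real.sin y) * ((3 : ℕ) * y ^ (3 - 1))) / (y ^ 3) ^ 2) y := by
    intro y hy
    exact ((hasDerivAt_id y).sub (Real.hasDerivAt_sin y)).div (hasDerivAt_pow 3 y) (by positivity)
  refine antitoneOn_of_deriv_nonpos (convex_Ioi _) ?_ ?_ ?_
  · intro y hy; exact (hd y hy).continuousAt.continuousWithinAt
  · rw [interior_Ioi]; intro y hy; exact (hd y hy).differentiableAt.differentiableWithinAt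
  · rw [interior_Ioi]; intro y hy
    rw [(hd y hy).deriv]
    have hy : 0 < y := hy
    apply div_nonpos_of_nonpos_of_nonneg _ (by positivity)
    have := cusa y hy.le
    have h2 := mul_le_mul_of_nonneg_left this (sq_nonneg y)
    norm_num
    nlinarith

lemma trunc_posdef (δ : ℝ) (h0 : 0 < δ) (h1 : δ ≤ Real.pi) :
    IsPosDefKernel (fun x y : S2 => (max (δ - gcDist (x : EuclideanSpace ℝ (Fin 3)) y) 0) ^ 2) := by
  have hpi := Real.pi_pos
  refine cos_series_posdef (fun m => if m = 0 then δ ^ 3 / (3 * Real.pi) else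
    2 * (m * δ - Real.sin (m * δ)) / (Real.pi * m ^ 3)) ?_ ?_ (fun θ => (max (δ - θ) 0) ^ 2) ?_
  · intro m
    split_ifs
    · positivity
    · have : Real.sin (m * δ) ≤ m * δ := Real.sin_le (by positivity)
      apply div_nonneg _ (by positivity)
      linarith
  · intro m
    have e : ∀ m : ℕ, m ≠ 0 → 2 * (m * δ - Real.sin (m * δ)) / (Real.pi * m ^ 3) =
        2 * δ ^ 3 / Real.pi * ((m * δ - Real.sin (m * δ)) / (m * δ) ^ 3) := by
      intro m hm
      have : (m : ℝ) ≠ 0 := by exact_mod_cast hm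
      field_simp
    rw [if_neg (by omega), e _ (by omega)]
    split_ifs with hm
    · have hx : 0 < (((m + 2 : ℕ) : ℝ) * δ) := by positivity
      have : (((m + 2 : ℕ) : ℝ) * δ - Real.sin (((m + 2 : ℕ) : ℝ) * δ)) / (((m + 2 : ℕ) : ℝ) * δ) ^ 3 ≤ 1 / 6 := by
        rw [div_le_iff₀ (by positivity)]
        linarith [sub_sin_le _ hx.le]
      calc _ ≤ 2 * δ ^ 3 / Real.pi * (1 / 6) := by gcongr
        _ = _ := by field_simp; norm_num
    · rw [e m hm]
      have hm' : 0 < (m : ℝ) := by exact_mod_cast Nat.pos_of_ne_zero hm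
      have := phi_anti (show (m : ℝ) * δ ∈ Set.Ioi 0 from mul_pos hm' h0)
        (show ((m + 2 : ℕ) : ℝ) * δ ∈ Set.Ioi 0 from by
          have : 0 < (((m + 2 : ℕ) : ℝ) * δ) := by positivity
          exact this) (by push_cast; nlinarith)
      exact mul_le_mul_of_nonneg_left this (by positivity)
  · intro θ hθ
    have hC := C2_sum θ ⟨hθ.1, by linarith [hθ.2]⟩
    have hS1 := S3_sum (δ + θ) ⟨by linarith [hθ.1], by linarith [hθ.2]⟩
    have hS2 : HasSum (fun m : ℕ => 1 / ((m + 1 : ℕ) : ℝ) ^ 3 * Real.sin ((m + 1 : ℕ) * (δ - θ)))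
      (Real.pi ^ 2 * (δ - θ) / 6 - Real.pi * ((δ - θ) * |δ - θ|) / 4 + (δ - θ) ^ 3 / 12) := by
      rcases le_total θ δ with h | h
      · rw [abs_of_nonneg (by linarith)]
        have := S3_sum (δ - θ) ⟨by linarith, by linarith [hθ.1]⟩
        refine hasSum_cong this rfl ?_
        ring
      · rw [abs_of_nonpos (by linarith)]
        have := (S3_sum (θ - δ) ⟨by linarith, by linarith [hθ.2]⟩).neg
        refine hasSum_cong this ?_ ?_
        · funext m
          rw [show ((m + 1 : ℕ) : ℝ) * (δ - θ) = -(((m + 1 : ℕ) : ℝ) * (θ - δ)) by ring, Real.sin_neg]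
          ring
        · ring
    have H := ((hC.mul_left δ).sub ((hS1.add hS2).mul_left (1/2))).mul_left (4 / Real.pi)
    refine hasSum_cong H ?_ ?_
    · funext m
      have hm : ((m + 1 : ℕ) : ℝ) ≠ 0 := by positivity
      simp only [Nat.add_eq_zero_iff, one_ne_zero, and_false, if_false]
      have : Real.sin ((m + 1 : ℕ) * (δ + θ)) + Real.sin ((m + 1 : ℕ) * (δ - θ)) = 2 * Real.sin ((m + 1 : ℕ) * δ) * Real.cos ((m + 1 : ℕ) * θ) := by
        rw [mul_add, mul_sub, Real.sin_add, Real.sin_sub]; ring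
      rw [← mul_add, this]
      field_simp
      ring
    · rw [if_pos rfl]
      rcases le_total θ δ with h | h
      · rw [abs_of_nonneg (by linarith), max_eq_left (by linarith)]
        field_simp
        ring
      · rw [abs_of_nonpos (by linarith), max_eq_right (by linarith)]
        field_simp
        ring

lemma lin_posdef :
    IsPosDefKernel (fun x y : S2 => Real.pi - gcDist (x : EuclideanSpace ℝ (Fin 3)) y) := by
  have hpi := Real.pi_pos
  refine cos_series_posdef (fun m => if m = 0 then Real.pi / 2 else
    (1 - (-1) ^ m) / (Real.pi * m ^ 2)) ?_ ?_ (fun θ => Real.pi - θ) ?_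
  · intro m
    split_ifs
    · positivity
    · apply div_nonneg _ (by positivity)
      rcases neg_one_pow_eq_or ℝ m with h | h <;> rw [h] <;> norm_num
  · intro m
    rw [if_neg (by omega), pow_add]
    split_ifs with hm
    · subst hm; simp; positivity
    · have hm' : 0 < (m : ℝ) := by exact_mod_cast Nat.pos_of_ne_zero hm
      have hn : (0 : ℝ) ≤ 1 - (-1) ^ m := by
        rcases neg_one_pow_eq_or ℝ m with h | h <;> rw [h] <;> norm_num
      rw [show ((-1 : ℝ) ^ 2) = 1 by norm_num, mul_one]
      gcongr
      push_cast; linarith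
  · intro θ hθ
    have h1 := C2_sum θ ⟨hθ.1, by linarith [hθ.2]⟩
    have h2 := C2_sum (θ + Real.pi) ⟨by linarith [hθ.1], by linarith [hθ.2]⟩
    have H := (h1.sub h2).mul_left (2 / Real.pi)
    refine hasSum_cong H ?_ ?_
    · funext m
      have hm : ((m + 1 : ℕ) : ℝ) ≠ 0 := by positivity
      simp only [Nat.add_eq_zero_iff, one_ne_zero, and_false, if_false]
      rw [mul_add ((m + 1 : ℕ) : ℝ), Real.cos_add_nat_mul_pi]
      field_simp
    · rw [if_pos rfl]
      field_simp
      ring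

lemma const_posdef {X : Type*} (a : ℝ) (ha : 0 ≤ a) : IsPosDefKernel (fun _ _ : X => a) := by
  intro N x c
  have : ∑ i, ∑ j, c i * c j * a = a * (∑ i, c i) ^ 2 := by
    rw [sq, Finset.sum_mul_sum, Finset.mul_sum]
    refine Finset.sum_congr rfl fun i _ => ?_
    rw [Finset.mul_sum]
    refine Finset.sum_congr rfl fun j _ => ?_
    ring
  show 0 ≤ ∑ i, ∑ j, c i * c j * a
  rw [this]; positivity

lemma trunc_posdef_all (δ : ℝ) :
    IsPosDefKernel (fun x y : S2 => (max (δ - gcDist (x : EuclideanSpace ℝ (Fin 3)) y) 0) ^ 2) := by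
  rcases le_or_gt δ 0 with h | h
  · intro N x c
    refine le_of_eq ?_
    symm
    refine Finset.sum_eq_zero fun i _ => Finset.sum_eq_zero fun j _ => ?_
    have : 0 ≤ gcDist (x i : EuclideanSpace ℝ (Fin 3)) (x j) := Real.arccos_nonneg _
    simp only
    rw [max_eq_right (by linarith)]; ring
  rcases le_or_gt δ Real.pi with h1 | h1
  · exact trunc_posdef δ h h1
  · intro N x c
    have a1 := trunc_posdef Real.pi Real.pi_pos le_rfl N x c
    have a2 := lin_posdef N x c
    have a3 := const_posdef ((δ - Real.pi) ^ 2) (sq_nonneg _) N x c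
    have a2' := mul_nonneg (by linarith : 0 ≤ 2 * (δ - Real.pi)) a2
    have := add_nonneg (add_nonneg a1 a2') a3
    refine this.trans (le_of_eq ?_)
    simp only [Finset.mul_sum, ← Finset.sum_add_distrib]
    refine Finset.sum_congr rfl fun i _ => Finset.sum_congr rfl fun j _ => ?_
    have : gcDist (x i : EuclideanSpace ℝ (Fin 3)) (x j) ≤ Real.pi := Real.arccos_le_pi _
    rw [max_eq_left (by linarith), max_eq_left (by linarith)]
    ring

open MeasureTheory in
lemma min_schur (N : ℕ) (k : Fin N → Fin N → ℝ)
    (hk : ∀ c : Fin N → ℝ, 0 ≤ ∑ i, ∑ j, c i * c j * k i j) (a : Fin N → ℝ) (ha : ∀ i, 0 < a i)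
    (c : Fin N → ℝ) : 0 ≤ ∑ i, ∑ j, c i * c j * (k i j * min (a i) (a j)) := by
  have hI : ∀ i j, Integrable (fun t : ℝ => (Set.Ioc 0 (min (a i) (a j))).indicator (fun _ => (1 : ℝ)) t) := by
    intro i j
    exact (integrable_indicator_iff measurableSet_Ioc).mpr (integrableOn_const (by simp))
  have hv : ∀ i j, ∫ t : ℝ, (Set.Ioc 0 (min (a i) (a j))).indicator (fun _ => (1 : ℝ)) t = min (a i) (a j) := by
    intro i j
    rw [integral_indicator measurableSet_Ioc]
    simp [(ha i).le, (ha j).le]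
  have e : ∑ i, ∑ j, c i * c j * (k i j * min (a i) (a j)) =
      ∫ t : ℝ, ∑ i, ∑ j, c i * c j * (k i j * (Set.Ioc 0 (min (a i) (a j))).indicator (fun _ => (1 : ℝ)) t) := by
    rw [integral_finsetSum]
    · refine Finset.sum_congr rfl fun i _ => ?_
      rw [integral_finsetSum]
      · refine Finset.sum_congr rfl fun j _ => ?_
        rw [integral_const_mul, integral_const_mul, hv]
      · intro j _
        exact ((hI i j).const_mul _).const_mul _
    · intro i _
      refine integrable_finsetSum _ fun j _ => ?_
      exact ((hI i j).const_mul _).const_mul _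
  rw [e]
  refine integral_nonneg fun t => ?_
  have := hk (fun i => c i * (Set.Ioc 0 (a i)).indicator (fun _ => (1 : ℝ)) t)
  refine this.trans (le_of_eq ?_)
  refine Finset.sum_congr rfl fun i _ => Finset.sum_congr rfl fun j _ => ?_
  have : (Set.Ioc 0 (min (a i) (a j))).indicator (fun _ => (1 : ℝ)) t =
      (Set.Ioc 0 (a i)).indicator (fun _ => (1 : ℝ)) t * (Set.Ioc 0 (a j)).indicator (fun _ => (1 : ℝ)) t := by
    simp only [Set.indicator_apply, Set.mem_Ioc, le_min_iff]
    by_cases h1 : 0 < t <;> by_cases h2 : t ≤ a i <;> by_cases h3 : t ≤ a j <;> simp [h1, h2, h3]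
  rw [this]; ring

lemma exp_schur (N : ℕ) (k : Fin N → Fin N → ℝ)
    (hk : ∀ c : Fin N → ℝ, 0 ≤ ∑ i, ∑ j, c i * c j * k i j) (t : Fin N → ℝ) (l : ℝ) (hl : 0 ≤ l)
    (c : Fin N → ℝ) : 0 ≤ ∑ i, ∑ j, c i * c j * (k i j * Real.exp (-(l * |t i - t j|))) := by
  have := min_schur N k hk (fun i => Real.exp (2 * l * t i)) (fun i => Real.exp_pos _)
    (fun i => c i * Real.exp (-(l * t i)))
  refine this.trans (le_of_eq ?_)
  refine Finset.sum_congr rfl fun i _ => Finset.sum_congr rfl fun j _ => ?_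
  have : Real.exp (-(l * |t i - t j|)) = Real.exp (-(l * t i)) * Real.exp (-(l * t j)) * min (Real.exp (2 * l * t i)) (Real.exp (2 * l * t j)) := by
    rcases le_total (t i) (t j) with h | h
    · rw [abs_of_nonpos (by linarith), min_eq_left (Real.exp_le_exp.mpr (by gcongr)), ← Real.exp_add, ← Real.exp_add]
      congr 1; ring
    · rw [abs_of_nonneg (by linarith), min_eq_right (Real.exp_le_exp.mpr (by gcongr)), ← Real.exp_add, ← Real.exp_add]
      congr 1; ring
  rw [this]; ring

open MeasureTheory in
lemma trunc_integral (κ : ℝ) (hκ : 0 < κ) (θ : ℝ) :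
    Integrable (fun δ : ℝ => (max (δ - θ) 0) ^ 2 * Real.exp (-(κ * δ))) ∧
    ∫ δ : ℝ, (max (δ - θ) 0) ^ 2 * Real.exp (-(κ * δ)) = 2 * Real.exp (-(κ * θ)) / κ ^ 3 := by
  set g : ℝ → ℝ := (Set.Ioi 0).indicator (fun t => t ^ (2 : ℝ) * Real.exp (-(κ * t))) with hg
  have hgI : Integrable g := by
    rw [hg, integrable_indicator_iff measurableSet_Ioi]
    have := integrableOn_rpow_mul_exp_neg_mul_rpow (p := 1) (s := 2) (b := κ) (by norm_num) one_pos hκ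
    simpa using this
  have hgv : ∫ t, g t = 2 / κ ^ 3 := by
    rw [hg, integral_indicator measurableSet_Ioi]
    have := Real.integral_rpow_mul_exp_neg_mul_Ioi (a := 3) (r := κ) (by norm_num) hκ
    rw [show (3 : ℝ) - 1 = 2 by norm_num] at this
    rw [this, show (3 : ℝ) = ((2 : ℕ) : ℝ) + 1 by norm_num, Real.Gamma_nat_eq_factorial,
      show ((2 : ℕ) : ℝ) + 1 = ((3 : ℕ) : ℝ) by norm_num, Real.rpow_natCast]
    simp [Nat.factorial]
    field_simp
  have e : (fun δ : ℝ => (max (δ - θ) 0) ^ 2 * Real.exp (-(κ * δ))) = fun δ => Real.exp (-(κ * θ)) * g (δ - θ) := by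
    funext δ
    simp only [hg, Set.indicator_apply, Set.mem_Ioi]
    split_ifs with h
    · rw [max_eq_left h.le, Real.rpow_two, mul_left_comm, ← Real.exp_add]
      congr 2; ring
    · rw [max_eq_right (by linarith)]; simp
  rw [e]
  refine ⟨(hgI.comp_sub_right θ).const_mul _, ?_⟩
  rw [integral_const_mul, integral_sub_right_eq_self g θ, hgv]
  ring

open MeasureTheory in
theorem modified_gneiting_posdef
    (σ2 bS bT : ℝ) (hσ : 0 < σ2) (hbS : 0 < bS) (hbT : 0 < bT) :
    IsPosDefKernel (fun p q : Metric.sphere (0 : EuclideanSpace ℝ (Fin 3)) 1 × ℝ =>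
      σ2 * (1 + |p.2 - q.2| / bT) ^ (-3 : ℝ) *
        Real.exp (-(gcDist (p.1 : EuclideanSpace ℝ (Fin 3)) (q.1 : EuclideanSpace ℝ (Fin 3)) *
            (1 + |p.2 - q.2| / bT)) / bS)) := by
  intro N p c
  have hγ : ∀ i j, 0 < 1 + |(p i).2 - (p j).2| / bT := fun i j => by positivity
  have hT := fun i j => trunc_integral ((1 + |(p i).2 - (p j).2| / bT) / bS) (div_pos (hγ i j) hbS)
    (gcDist ((p i).1 : EuclideanSpace ℝ (Fin 3)) (p j).1)
  set f : Fin N → Fin N → ℝ → ℝ := fun i j δ =>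
    (max (δ - gcDist ((p i).1 : EuclideanSpace ℝ (Fin 3)) (p j).1) 0) ^ 2 *
      Real.exp (-((1 + |(p i).2 - (p j).2| / bT) / bS * δ)) with hf
  have e : (∑ i, ∑ j, c i * c j * (σ2 * (1 + |(p i).2 - (p j).2| / bT) ^ (-3 : ℝ) *
        Real.exp (-(gcDist ((p i).1 : EuclideanSpace ℝ (Fin 3)) ((p j).1 : EuclideanSpace ℝ (Fin 3)) *
            (1 + |(p i).2 - (p j).2| / bT)) / bS))) =
      σ2 / (2 * bS ^ 3) * ∫ δ : ℝ, ∑ i, ∑ j, c i * c j * f i j δ := by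
    rw [integral_finsetSum]
    · rw [Finset.mul_sum]
      refine Finset.sum_congr rfl fun i _ => ?_
      rw [integral_finsetSum]
      · rw [Finset.mul_sum]
        refine Finset.sum_congr rfl fun j _ => ?_
        have h3 : (1 + |(p i).2 - (p j).2| / bT) ^ (-3 : ℝ) = ((1 + |(p i).2 - (p j).2| / bT) ^ 3)⁻¹ := by
          rw [Real.rpow_neg (hγ i j).le, ← Real.rpow_natCast]; norm_num
        rw [integral_const_mul, (hT i j).2, h3]
        have he : -((1 + |(p i).2 - (p j).2| / bT) / bS * gcDist ((p i).1 : EuclideanSpace ℝ (Fin 3)) (p j).1) =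
          -(gcDist ((p i).1 : EuclideanSpace ℝ (Fin 3)) ((p j).1 : EuclideanSpace ℝ (Fin 3)) *
            (1 + |(p i).2 - (p j).2| / bT)) / bS := by ring
        rw [he]
        have := hγ i j
        generalize 1 + |(p i).2 - (p j).2| / bT = γ at *
        field_simp
      · intro j _
        exact (hT i j).1.const_mul _
    · intro i _
      exact integrable_finsetSum _ fun j _ => (hT i j).1.const_mul _
  refine le_of_le_of_eq ?_ e.symm
  refine mul_nonneg (by positivity) (integral_nonneg fun δ => ?_)
  rcases le_or_gt δ 0 with h | h
  · refine le_of_eq ?_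
    symm
    refine Finset.sum_eq_zero fun i _ => Finset.sum_eq_zero fun j _ => ?_
    have : 0 ≤ gcDist ((p i).1 : EuclideanSpace ℝ (Fin 3)) (p j).1 := Real.arccos_nonneg _
    simp only [hf]
    rw [max_eq_right (by linarith)]; ring
  · have := exp_schur N (fun i j => (max (δ - gcDist ((p i).1 : EuclideanSpace ℝ (Fin 3)) (p j).1) 0) ^ 2)
      (fun c => trunc_posdef_all δ N (fun i => (p i).1) c) (fun i => (p i).2) (δ / (bS * bT)) (by positivity) c
    have h2 := mul_nonneg (Real.exp_pos (-(δ / bS))).le this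
    refine h2.trans (le_of_eq ?_)
    simp only [hf, Finset.mul_sum]
    refine Finset.sum_congr rfl fun i _ => Finset.sum_congr rfl fun j _ => ?_
    have : Real.exp (-((1 + |(p i).2 - (p j).2| / bT) / bS * δ)) = Real.exp (-(δ / bS)) * Real.exp (-(δ / (bS * bT) * |(p i).2 - (p j).2|)) := by
      rw [← Real.exp_add]; congr 1; field_simp; ring
    rw [this]; ring
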